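/- Let G, H ∈ Ĝ₀ be jointless unlabeled graphs of finite norm, let x₁ = max spec(G) and x₂ = max spec(H) (or alternatively x₁ = min spec(G) and x₂ = min spec(H)), and let G' = del(G, x₁) and H' = del(H, x₂). Then d(G, H) = d(G', H') + |x₁ − x₂|. -/

import Mathlib

open scoped ENNReal
open Filter Topology

/-- Edges: 2-element subsets of the vertex set `ℕ`. -/
abbrev Edge : Type := {e : Sym2 ℕ // ¬ e.IsDiag}

/-- A labeled graph: an assignment of a real weight to each edge. -/
abbrev LGraph : Type := Edge → ℝ

/-- The norm of a labeled graph: the sum of the absolute values of its edge weights. -/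
noncomputable def gnorm (w : LGraph) : ℝ≥0∞ := ∑' e : Edge, ENNReal.ofReal |w e|

/-- A labeled graph has finite norm if its norm is finite. -/
def FiniteNorm (w : LGraph) : Prop := gnorm w ≠ ⊤

/-- The distance between two labeled graphs: `d(w,w') = |w - w'|`. -/
noncomputable def ldist (w w' : LGraph) : ℝ≥0∞ := ∑' e : Edge, ENNReal.ofReal |w e - w' e|

/-- A vertex is isolated if every edge containing it has weight `0`. -/
def Isolated (w : LGraph) (v : ℕ) : Prop := ∀ e : Edge, v ∈ e.val → w e = 0

/-- A labeled graph is standard if it has infinitely many isolated vertices. -/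
def Standard (w : LGraph) : Prop := {v : ℕ | Isolated w v}.Infinite

/-- The image of an edge under a bijection of the vertex set. -/
def mapEdge (f : ℕ ≃ ℕ) (e : Edge) : Edge :=
  ⟨e.val.map f, fun h => e.prop ((Sym2.isDiag_map f.injective).mp h)⟩

/-- Two labeled graphs are isomorphic if some bijection of the vertices carries the
weights of one to the other: `w(uv) = w'(f(u)f(v))` for all edges `uv`. -/
def GIso (w w' : LGraph) : Prop := ∃ f : ℕ ≃ ℕ, ∀ e : Edge, w e = w' (mapEdge f e)

/-- The isomorphism class of a labeled graph (as a set of labeled graphs). -/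
def cls (w : LGraph) : Set LGraph := {w' | GIso w w'}

/-- The distance between the isomorphism classes of two labeled graphs:
`d(G,G') = inf { d(u,v) : u ∈ G, v ∈ G' }`. -/
noncomputable def Gdist (w₁ w₂ : LGraph) : ℝ≥0∞ := ⨅ u ∈ cls w₁, ⨅ v ∈ cls w₂, ldist u v

/-- A graph is jointless if no two edges of nonzero weight share a vertex. -/
def Jointless (w : LGraph) : Prop :=
  ∀ e e' : Edge, e ≠ e' → w e ≠ 0 → w e' ≠ 0 → ∀ v : ℕ, v ∈ e.val → v ∉ e'.val

lemma mem_mapEdge {f : ℕ ≃ ℕ} {e : Edge} {v : ℕ} :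
    v ∈ (mapEdge f e).val ↔ f.symm v ∈ e.val := by
  simp only [mapEdge, Sym2.mem_map]
  constructor
  · rintro ⟨a, ha, rfl⟩
    simpa using ha
  · intro h
    exact ⟨_, h, by simp⟩

lemma mapEdge_trans (f g : ℕ ≃ ℕ) (e : Edge) :
    mapEdge (f.trans g) e = mapEdge g (mapEdge f e) :=
  Subtype.ext (by simp [mapEdge, Sym2.map_map])

lemma mapEdge_eq_self {f : ℕ ≃ ℕ} {e : Edge} (h : ∀ v ∈ e.val, f v = v) : mapEdge f e = e := by
  apply Subtype.ext
  have := Sym2.map_congr (f := f) (g := id) (s := e.val) h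
  simpa [mapEdge] using this

/-- The permutation of the edges induced by a permutation of the vertices. -/
def mapEdgeEquiv (f : ℕ ≃ ℕ) : Edge ≃ Edge where
  toFun := mapEdge f
  invFun := mapEdge f.symm
  left_inv e := by
    rw [← mapEdge_trans]
    exact mapEdge_eq_self (by simp)
  right_inv e := by
    rw [← mapEdge_trans]
    exact mapEdge_eq_self (by simp)

lemma GIso.refl (w : LGraph) : GIso w w :=
  ⟨Equiv.refl ℕ, fun e => by rw [mapEdge_eq_self (by simp)]⟩

lemma GIso.trans {u v w : LGraph} (h : GIso u v) (h' : GIso v w) : GIso u w := by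
  obtain ⟨f, hf⟩ := h
  obtain ⟨g, hg⟩ := h'
  exact ⟨f.trans g, fun e => by rw [hf, hg, mapEdge_trans]⟩

lemma GIso.symm {u v : LGraph} (h : GIso u v) : GIso v u := by
  obtain ⟨f, hf⟩ := h
  exact ⟨f.symm, fun e => by
    rw [hf]; exact congrArg v ((mapEdgeEquiv f).right_inv e).symm⟩

lemma gIso_comp (w : LGraph) (f : ℕ ≃ ℕ) : GIso (fun e => w (mapEdge f e)) w :=
  ⟨f, fun _ => rfl⟩

lemma GIso.jointless {u v : LGraph} (h : GIso u v) (hv : Jointless v) : Jointless u := by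
  obtain ⟨f, hf⟩ := h
  intro e e' hne he he' a ha ha'
  rw [hf] at he he'
  exact hv _ _ ((mapEdgeEquiv f).injective.ne hne) he he' (f a)
    (mem_mapEdge.2 (by simpa using ha)) (mem_mapEdge.2 (by simpa using ha'))

lemma GIso.range_eq {u v : LGraph} (h : GIso u v) : Set.range u = Set.range v := by
  obtain ⟨f, hf⟩ := h
  have : u = v ∘ mapEdgeEquiv f := funext hf
  rw [this, EquivLike.range_comp]

lemma GIso.gnorm_eq {u v : LGraph} (h : GIso u v) : gnorm u = gnorm v := by
  obtain ⟨f, hf⟩ := h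
  simp only [gnorm, hf]
  exact (mapEdgeEquiv f).tsum_eq (fun e => ENNReal.ofReal |v e|)

lemma isolated_comp {w : LGraph} {f : ℕ ≃ ℕ} {a : ℕ} (h : Isolated w (f a)) :
    Isolated (fun e => w (mapEdge f e)) a :=
  fun _ he => h _ (mem_mapEdge.2 (by simpa using he))

lemma GIso.standard {u v : LGraph} (h : GIso u v) (hv : Standard v) : Standard u := by
  obtain ⟨f, hf⟩ := h
  obtain rfl : u = fun e => v (mapEdge f e) := funext hf
  refine (hv.image f.symm.injective.injOn).mono ?_
  rintro _ ⟨a, ha, rfl⟩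
  exact isolated_comp (by simpa using ha)

/-- Changing the weight of an edge and of its image to the same value keeps `f` an isomorphism. -/
lemma update_mapEdge_eq {w u : LGraph} {f : ℕ ≃ ℕ} (hf : ∀ e, w e = u (mapEdge f e))
    (p : Edge) (x : ℝ) (e : Edge) :
    Function.update w p x e = Function.update u (mapEdge f p) x (mapEdge f e) := by
  by_cases h : e = p
  · subst h; simp
  · have h' : mapEdge f e ≠ mapEdge f p := (mapEdgeEquiv f).injective.ne h
    rw [Function.update_of_ne h, Function.update_of_ne h', hf]

lemma apply_mapEdge_swap {u : LGraph} {a b : ℕ} (ha : Isolated u a) (hb : Isolated u b)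
    (e : Edge) : u (mapEdge (Equiv.swap a b) e) = u e := by
  by_cases hae : a ∈ e.val
  · rw [ha e hae, hb]
    rw [mem_mapEdge]; simpa using hae
  by_cases hbe : b ∈ e.val
  · rw [hb e hbe, ha]
    rw [mem_mapEdge]; simpa using hbe
  rw [mapEdge_eq_self]
  intro v hv
  exact Equiv.swap_apply_of_ne_of_ne (by rintro rfl; exact hae hv) (by rintro rfl; exact hbe hv)

/-- Attaching an edge of weight `x` at isolated positions preserves isomorphism. -/
lemma GIso.update_of_isolated {w u : LGraph} (h : GIso w u) {e p : Edge}
    (he : ∀ v ∈ e.val, Isolated w v) (hp : ∀ v ∈ p.val, Isolated u v) (x : ℝ) :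
    GIso (Function.update w e x) (Function.update u p x) := by
  obtain ⟨f, hf⟩ := h
  have hfe : ∀ v ∈ (mapEdge f e).val, Isolated u v := by
    intro v hv d hd
    obtain ⟨d', rfl⟩ := (mapEdgeEquiv f).surjective d
    change u (mapEdge f d') = 0
    rw [← hf]
    exact he _ (mem_mapEdge.1 hv) _ (mem_mapEdge.1 hd)
  suffices H : ∀ q : Edge, (∀ v ∈ q.val, Isolated u v) →
      ∃ g : ℕ ≃ ℕ, (∀ d, u (mapEdge g d) = u d) ∧ mapEdge g q = p by
    obtain ⟨g, hg, hgp⟩ := H _ hfe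
    refine ⟨f.trans g, fun d => ?_⟩
    have := update_mapEdge_eq (w := w) (u := u) (f := f.trans g)
      (fun d => by rw [mapEdge_trans, hg, hf]) e x d
    rwa [mapEdge_trans f g e, hgp] at this
  rintro ⟨q, hq⟩ hqi
  obtain ⟨p, hp'⟩ := p
  induction q with | _ s t => ?_
  induction p with | _ a b => ?_
  simp only [Sym2.mem_iff, forall_eq_or_imp, forall_eq] at hp hqi
  have hst : s ≠ t := hq
  have hab : a ≠ b := hp'
  have ht : Isolated u (Equiv.swap s a t) := by
    rw [Equiv.swap_apply_def]
    split_ifs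
    exacts [hp.1, hqi.1, hqi.2]
  have hta : a ≠ Equiv.swap s a t := by
    intro h
    have := congrArg (Equiv.swap s a) h
    simp at this
    exact hst this
  refine ⟨(Equiv.swap s a).trans (Equiv.swap (Equiv.swap s a t) b), fun d => ?_, ?_⟩
  · rw [mapEdge_trans, apply_mapEdge_swap ht hp.2, apply_mapEdge_swap hqi.1 hp.1]
  · apply Subtype.ext
    simp [mapEdge, Equiv.swap_apply_of_ne_of_ne hta hab]

/-- The total absolute weight of the edges at a vertex. -/
noncomputable def vertexWeight (w : LGraph) (a : ℕ) : ℝ≥0∞ :=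
  ∑' e : Edge, if a ∈ e.val then ENNReal.ofReal |w e| else 0

lemma tsum_vertexWeight_le (w : LGraph) : ∑' a, vertexWeight w a ≤ 2 * gnorm w := by
  unfold vertexWeight gnorm
  rw [ENNReal.tsum_comm, ← ENNReal.tsum_mul_left]
  refine ENNReal.tsum_le_tsum fun e => ?_
  obtain ⟨e, he⟩ := e
  generalize w ⟨e, he⟩ = r
  induction e with | _ x y => ?_
  calc ∑' a, (if a ∈ s(x, y) then ENNReal.ofReal |r| else 0)
      ≤ ∑' a, ((if a = x then ENNReal.ofReal |r| else 0)
          + (if a = y then ENNReal.ofReal |r| else 0)) := by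
        refine ENNReal.tsum_le_tsum fun a => ?_
        by_cases h1 : a = x <;> by_cases h2 : a = y <;> simp [h1, h2]
    _ = 2 * ENNReal.ofReal |r| := by
        rw [ENNReal.tsum_add, tsum_ite_eq, tsum_ite_eq, two_mul]

lemma exists_vertexWeight_lt {w : LGraph} (hw : FiniteNorm w) {S : Set ℕ} (hS : S.Infinite)
    {ε : ℝ≥0∞} (hε : 0 < ε) : ∃ a ∈ S, vertexWeight w a < ε := by
  have hne : ∑' a, vertexWeight w a ≠ ⊤ :=
    ne_top_of_le_ne_top (ENNReal.mul_ne_top (by simp) hw) (tsum_vertexWeight_le w)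
  have ht := (ENNReal.tendsto_cofinite_zero_of_tsum_ne_top hne).eventually (gt_mem_nhds hε)
  obtain ⟨a, haS, ha⟩ := ((frequently_cofinite_iff_infinite.2 hS).and_eventually ht).exists
  exact ⟨a, haS, ha⟩

lemma ldist_triangle (u v w : LGraph) : ldist u w ≤ ldist u v + ldist v w := by
  unfold ldist
  rw [← ENNReal.tsum_add]
  refine ENNReal.tsum_le_tsum fun e => ?_
  rw [← ENNReal.ofReal_add (abs_nonneg _) (abs_nonneg _)]
  exact ENNReal.ofReal_le_ofReal (abs_sub_le _ _ _)

lemma ldist_swap_le {v : LGraph} {a c : ℕ} (hc : Isolated v c) :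
    ldist v (fun e => v (mapEdge (Equiv.swap a c) e)) ≤ 2 * vertexWeight v a := by
  set σ := Equiv.swap a c with hσ
  have hsum : ∑' e : Edge, (if a ∈ (mapEdge σ e).val then
      ENNReal.ofReal |v (mapEdge σ e)| else 0) = vertexWeight v a :=
    (mapEdgeEquiv σ).tsum_eq (fun e => if a ∈ e.val then ENNReal.ofReal |v e| else 0)
  rw [two_mul]
  nth_rewrite 2 [← hsum]
  unfold ldist vertexWeight
  rw [← ENNReal.tsum_add]
  refine ENNReal.tsum_le_tsum fun e => ?_
  beta_reduce
  have hσa : a ∈ (mapEdge σ e).val ↔ c ∈ e.val := by rw [mem_mapEdge]; simp [hσ]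
  have hσc : c ∈ (mapEdge σ e).val ↔ a ∈ e.val := by rw [mem_mapEdge]; simp [hσ]
  by_cases h1 : a ∈ e.val
  · rw [hc _ (hσc.2 h1)]
    simp [h1]
  by_cases h2 : c ∈ e.val
  · rw [hc _ h2]
    simp [hσa.2 h2]
  rw [mapEdge_eq_self]
  · simp
  · intro x hx
    exact Equiv.swap_apply_of_ne_of_ne (by rintro rfl; exact h1 hx) (by rintro rfl; exact h2 hx)

/-- Up to an arbitrarily small change of distance, one can make a new vertex isolated in both
graphs while keeping finitely many given isolated vertices. -/
lemma exists_common_isolated {u v : LGraph} (hu : Standard u) (hv : Standard v)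
    (hf : FiniteNorm v) (F : Finset ℕ) (hF : ∀ b ∈ F, Isolated v b) {ε : ℝ≥0∞} (hε : 0 < ε) :
    ∃ v', GIso v v' ∧ ldist u v' ≤ ldist u v + 2 * ε ∧ (∀ b ∈ F, Isolated v' b) ∧
      ∃ a ∉ F, Isolated u a ∧ Isolated v' a := by
  obtain ⟨a, ⟨hau, haF⟩, ha⟩ := exists_vertexWeight_lt hf (hu.sdiff F.finite_toSet) hε
  obtain ⟨c, hcv, hcF⟩ := (hv.sdiff F.finite_toSet).nonempty
  refine ⟨fun e => v (mapEdge (Equiv.swap a c) e), (gIso_comp v _).symm, ?_, ?_, a, haF, hau, ?_⟩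
  · refine (ldist_triangle u v _).trans ?_
    gcongr
    exact (ldist_swap_le hcv).trans (by gcongr)
  · intro b hb
    apply isolated_comp
    rw [Equiv.swap_apply_of_ne_of_ne]
    · exact hF b hb
    · rintro rfl; exact haF hb
    · rintro rfl; exact hcF hb
  · apply isolated_comp
    simpa using hcv

/-- Up to an arbitrarily small change of distance, two standard graphs have an edge whose
endpoints are isolated in both. -/
lemma exists_common_isolated_edge {u v : LGraph} (hu : Standard u) (hv : Standard v)
    (hf : FiniteNorm v) {ε : ℝ≥0∞} (hε : 0 < ε) :
    ∃ v', GIso v v' ∧ ldist u v' ≤ ldist u v + 4 * ε ∧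
      ∃ p : Edge, ∀ a ∈ p.val, Isolated u a ∧ Isolated v' a := by
  obtain ⟨v₁, h₁, hd₁, -, a, -, hua, hva⟩ := exists_common_isolated hu hv hf ∅ (by simp) hε
  have hf₁ : FiniteNorm v₁ := by
    rw [FiniteNorm, ← h₁.gnorm_eq]; exact hf
  obtain ⟨v₂, h₂, hd₂, hva₂, b, hb, hub, hvb⟩ :=
    exists_common_isolated hu (h₁.symm.standard hv) hf₁ {a} (by simpa using hva) hε
  refine ⟨v₂, h₁.trans h₂, ?_, ⟨s(a, b), ?_⟩, ?_⟩
  · calc ldist u v₂ ≤ ldist u v₁ + 2 * ε := hd₂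
      _ ≤ ldist u v + 2 * ε + 2 * ε := by gcongr
      _ = ldist u v + 4 * ε := by ring
  · simpa [eq_comm] using hb
  · simp only [Sym2.mem_iff, forall_eq_or_imp, forall_eq]
    exact ⟨⟨hua, hva₂ a (by simp)⟩, hub, hvb⟩

lemma ldist_update (u v : LGraph) (p : Edge) (a b : ℝ) :
    ldist (Function.update u p a) (Function.update v p b) =
      ldist (Function.update u p 0) (Function.update v p 0) + ENNReal.ofReal |a - b| := by
  have h : ENNReal.ofReal |a - b| =
      ∑' e : Edge, if e = p then ENNReal.ofReal |a - b| else 0 := (tsum_ite_eq p fun _ => _).symm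
  rw [h]
  unfold ldist
  rw [← ENNReal.tsum_add]
  refine tsum_congr fun e => ?_
  by_cases h : e = p
  · subst h; simp
  · simp [h]

lemma Gdist_le {w₁ w₂ u v : LGraph} (hu : GIso w₁ u) (hv : GIso w₂ v) :
    Gdist w₁ w₂ ≤ ldist u v :=
  (iInf₂_le u hu).trans (iInf₂_le v hv)

lemma Jointless.isolated_update {w : LGraph} (hw : Jointless w) {e : Edge} (he : w e ≠ 0) :
    ∀ v ∈ e.val, Isolated (Function.update w e 0) v := by
  intro v hv d hd
  by_cases h : d = e
  · simp [h]
  · rw [Function.update_of_ne h]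
    by_contra hd0
    exact hw d e h hd0 he v hd hv

lemma Isolated.update {w : LGraph} {a : ℕ} (h : Isolated w a) (e : Edge) :
    Isolated (Function.update w e 0) a := by
  intro d hd
  by_cases hde : d = e
  · simp [hde]
  · rw [Function.update_of_ne hde, h d hd]

lemma Standard.update {w : LGraph} (h : Standard w) (e : Edge) :
    Standard (Function.update w e 0) :=
  h.mono fun _ ha => Isolated.update ha e

lemma FiniteNorm.update {w : LGraph} (h : FiniteNorm w) (e : Edge) :
    FiniteNorm (Function.update w e 0) := by
  refine ne_top_of_le_ne_top h (ENNReal.tsum_le_tsum fun d => ?_)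
  by_cases hde : d = e
  · simp [hde]
  · rw [Function.update_of_ne hde]

lemma Standard.zero_mem_range {w : LGraph} (h : Standard w) : (0 : ℝ) ∈ Set.range w := by
  obtain ⟨a, ha⟩ := h.nonempty
  exact ⟨⟨s(a, a + 1), by simp⟩, ha _ (by simp)⟩

/-- Reattaching a deleted edge at any isolated position recovers the original graph. -/
lemma Jointless.gIso_update {w u : LGraph} (hw : Jointless w) {e p : Edge}
    (h : GIso (Function.update w e 0) u) (hp : ∀ a ∈ p.val, Isolated u a) :
    GIso w (Function.update u p (w e)) := by
  by_cases he : w e = 0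
  · have hpu : u p = 0 := hp _ (Sym2.out_fst_mem p.val) p (Sym2.out_fst_mem p.val)
    rw [← he, Function.update_eq_self] at h
    rwa [he, ← hpu, Function.update_eq_self]
  · have := h.update_of_isolated (hw.isolated_update he) hp (w e)
    simpa using this

lemma Gdist_le_del {w₁ w₂ : LGraph} (hs₁ : Standard w₁) (hj₁ : Jointless w₁)
    (hs₂ : Standard w₂) (hf₂ : FiniteNorm w₂) (hj₂ : Jointless w₂) (e₁ e₂ : Edge) :
    Gdist w₁ w₂ ≤ Gdist (Function.update w₁ e₁ 0) (Function.update w₂ e₂ 0) +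
      ENNReal.ofReal |w₁ e₁ - w₂ e₂| := by
  conv_rhs => rw [Gdist]
  simp only [ENNReal.iInf_add]
  refine le_iInf₂ fun u hu => le_iInf₂ fun v hv => ?_
  refine ENNReal.le_of_forall_pos_le_add fun ε hε _ => ?_
  have hε' : (0 : ℝ≥0∞) < ε / 4 := ENNReal.div_pos (by simpa using hε.ne') (by simp)
  obtain ⟨v', hvv', hd, p, hp⟩ := exists_common_isolated_edge
    (GIso.symm hu |>.standard (hs₁.update e₁)) (GIso.symm hv |>.standard (hs₂.update e₂))
    (by rw [FiniteNorm, ← GIso.gnorm_eq hv]; exact hf₂.update e₂) hε'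
  have hp0 : u p = 0 ∧ v' p = 0 :=
    ⟨(hp _ (Sym2.out_fst_mem p.val)).1 p (Sym2.out_fst_mem p.val),
      (hp _ (Sym2.out_fst_mem p.val)).2 p (Sym2.out_fst_mem p.val)⟩
  have hu0 : Function.update u p 0 = u := by rw [← hp0.1, Function.update_eq_self]
  have hv0 : Function.update v' p 0 = v' := by rw [← hp0.2, Function.update_eq_self]
  calc Gdist w₁ w₂
      ≤ ldist (Function.update u p (w₁ e₁)) (Function.update v' p (w₂ e₂)) :=
        Gdist_le (hj₁.gIso_update hu fun a ha => (hp a ha).1)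
          (hj₂.gIso_update (GIso.trans hv hvv') fun a ha => (hp a ha).2)
    _ = ldist u v' + ENNReal.ofReal |w₁ e₁ - w₂ e₂| := by rw [ldist_update, hu0, hv0]
    _ ≤ ldist u v + 4 * (ε / 4) + ENNReal.ofReal |w₁ e₁ - w₂ e₂| := by gcongr
    _ = ldist u v + ENNReal.ofReal |w₁ e₁ - w₂ e₂| + ε := by
        rw [ENNReal.mul_div_cancel (by simp) (by simp), add_right_comm]

/-- Uncrossing a pair of matches at the extreme values does not increase the cost. -/
lemma abs_sub_add_abs_sub_le {x₁ x₂ y z : ℝ}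
    (h : (z ≤ x₁ ∧ y ≤ x₂) ∨ (x₁ ≤ z ∧ x₂ ≤ y)) :
    |z - y| + |x₁ - x₂| ≤ |x₁ - y| + |z - x₂| := by
  rcases h with ⟨h1, h2⟩ | ⟨h1, h2⟩ <;>
  rcases abs_cases (z - y) with h3 | h3 <;> rcases abs_cases (x₁ - x₂) with h4 | h4 <;>
  rcases abs_cases (x₁ - y) with h5 | h5 <;> rcases abs_cases (z - x₂) with h6 | h6 <;> linarith

lemma Gdist_del_le {w₁ w₂ : LGraph} (hj₁ : Jointless w₁) {e₁ e₂ : Edge} (h₂ : (0 : ℝ) ∈ Set.range w₂)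
    (hx : (IsGreatest (Set.range w₁) (w₁ e₁) ∧ IsGreatest (Set.range w₂) (w₂ e₂)) ∨
          (IsLeast (Set.range w₁) (w₁ e₁) ∧ IsLeast (Set.range w₂) (w₂ e₂))) :
    Gdist (Function.update w₁ e₁ 0) (Function.update w₂ e₂ 0) +
      ENNReal.ofReal |w₁ e₁ - w₂ e₂| ≤ Gdist w₁ w₂ := by
  conv_rhs => rw [Gdist]
  refine le_iInf₂ fun u hu => le_iInf₂ fun v hv => ?_
  have hju := (GIso.symm hu).jointless hj₁
  rw [GIso.range_eq hu, GIso.range_eq hv] at hx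
  rw [GIso.range_eq hv] at h₂
  obtain ⟨f, hf⟩ := hu
  obtain ⟨g, hg⟩ := hv
  have hu' : GIso (Function.update w₁ e₁ 0) (Function.update u (mapEdge f e₁) 0) :=
    ⟨f, update_mapEdge_eq hf e₁ 0⟩
  have hv' : GIso (Function.update w₂ e₂ 0) (Function.update v (mapEdge g e₂) 0) :=
    ⟨g, update_mapEdge_eq hg e₂ 0⟩
  rw [hf e₁, hg e₂] at hx ⊢
  generalize mapEdge f e₁ = p at *
  generalize mapEdge g e₂ = q at *
  by_cases hpq : p = q
  · subst hpq
    calc _ ≤ ldist (Function.update u p 0) (Function.update v p 0) +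
          ENNReal.ofReal |u p - v p| := by
          gcongr; exact Gdist_le hu' hv'
      _ = ldist u v := by rw [← ldist_update]; simp
  have hle : ∀ a ∈ Set.range u, ∀ b ∈ Set.range v,
      (a ≤ u p ∧ b ≤ v q) ∨ (u p ≤ a ∧ v q ≤ b) := fun a ha b hb =>
    hx.imp (fun h => ⟨h.1.2 ha, h.2.2 hb⟩) (fun h => ⟨h.1.2 ha, h.2.2 hb⟩)
  set B := Function.update (Function.update u p 0) q 0 with hB
  set C := Function.update (Function.update v p 0) q 0 with hC
  have huv : ldist u v = ldist B C + (ENNReal.ofReal |u p - v p| + ENNReal.ofReal |u q - v q|) := by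
    have h1 := ldist_update u v p (u p) (v p)
    have h2 := ldist_update (Function.update u p 0) (Function.update v p 0) q (u q) (v q)
    rw [Function.update_eq_self, Function.update_eq_self] at h1
    have h3 : ∀ w : LGraph,
        Function.update (Function.update w p 0) q (w q) = Function.update w p 0 := fun w => by
      rw [Function.update_eq_iff]
      exact ⟨by rw [Function.update_of_ne (Ne.symm hpq)], fun _ _ => rfl⟩
    rw [h3, h3] at h2
    rw [h1, h2, add_assoc, add_comm (ENNReal.ofReal |u q - v q|)]
  have key : ∀ u' v' : LGraph, GIso (Function.update w₁ e₁ 0) u' →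
      GIso (Function.update w₂ e₂ 0) v' → ∀ r : ℝ, 0 ≤ r →
      ldist u' v' = ldist B C + ENNReal.ofReal r →
      r + |u p - v q| ≤ |u p - v p| + |u q - v q| →
      Gdist (Function.update w₁ e₁ 0) (Function.update w₂ e₂ 0) +
        ENNReal.ofReal |u p - v q| ≤ ldist u v := by
    intro u' v' hu' hv' r hr hd hle
    calc _ ≤ ldist u' v' + ENNReal.ofReal |u p - v q| := by gcongr; exact Gdist_le hu' hv'
      _ = ldist B C + ENNReal.ofReal (r + |u p - v q|) := by
          rw [hd, add_assoc, ENNReal.ofReal_add hr (abs_nonneg _)]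
      _ ≤ ldist B C + ENNReal.ofReal (|u p - v p| + |u q - v q|) := by gcongr
      _ = ldist u v := by rw [huv, ENNReal.ofReal_add (abs_nonneg _) (abs_nonneg _)]
  have hup : Function.update B q (u q) = Function.update u p 0 := by
    rw [hB, Function.update_idem, Function.update_eq_iff]
    exact ⟨by rw [Function.update_of_ne (Ne.symm hpq)], fun _ _ => rfl⟩
  have hB' : B = Function.update (Function.update u q 0) p 0 := Function.update_comm hpq _ _ _
  have hC' : C = Function.update (Function.update v q 0) p 0 := Function.update_comm hpq _ _ _
  have hvq : Function.update C p (v p) = Function.update v q 0 := by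
    rw [hC', Function.update_idem, Function.update_eq_iff]
    exact ⟨by rw [Function.update_of_ne hpq], fun _ _ => rfl⟩
  have hB0 : Function.update B p 0 = B := by rw [hB', Function.update_idem]
  have hC0 : Function.update C p 0 = C := by rw [hC', Function.update_idem]
  have hB1 : Function.update B q 0 = B := by rw [hB, Function.update_idem]
  by_cases hnz : u p ≠ 0 ∧ u q ≠ 0
  · refine key (Function.update B p (u q)) (Function.update v q 0) ?_ hv' |u q - v p|
      (abs_nonneg _) ?_ (abs_sub_add_abs_sub_le (hle _ ⟨q, rfl⟩ _ ⟨p, rfl⟩))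
    · refine hu'.trans ?_
      rw [← hup]
      refine (GIso.refl B).update_of_isolated (fun a ha => ?_) (fun a ha => ?_) _
      · rw [hB']
        exact (hju.isolated_update hnz.2 a ha).update p
      · exact (hju.isolated_update hnz.1 a ha).update q
    · rw [← hvq, ldist_update, hB0, hC0]
  · refine key (Function.update u p 0) (Function.update v q 0) hu' hv' (|v p| + |u q|)
      (by positivity) ?_ ?_
    · have hBV := ldist_update B (Function.update v q 0) q (u q) 0
      rw [hup, hB1, Function.update_idem, sub_zero] at hBV
      have hBC := ldist_update B C p 0 (v p)
      rw [hB0, hC0, hvq, zero_sub, abs_neg] at hBC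
      rw [hBV, hBC, ENNReal.ofReal_add (abs_nonneg _) (abs_nonneg _), add_assoc]
    · by_cases hp0 : u p = 0
      · have hz := hle (u q) ⟨q, rfl⟩ 0 h₂
        rw [hp0] at hz ⊢
        rw [zero_sub, zero_sub, abs_neg, abs_neg]
        rcases hz with ⟨h1, h2⟩ | ⟨h1, h2⟩
        · rw [abs_of_nonpos h1, abs_of_nonneg h2, abs_of_nonpos (a := u q - v q) (by linarith)]
          linarith
        · rw [abs_of_nonneg h1, abs_of_nonpos h2, abs_of_nonneg (a := u q - v q) (by linarith)]
          linarith
      · have hq0 : u q = 0 := by tauto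
        have := abs_sub_add_abs_sub_le (hle _ ⟨q, rfl⟩ _ ⟨p, rfl⟩)
        simpa [hq0] using this

/-- For jointless graphs, deleting one maximal-weight edge from each graph (or one
minimal-weight edge from each) decreases the distance by exactly `|x₁ - x₂|`. -/
theorem dist_del_extreme (w₁ w₂ : LGraph)
    (hs₁ : Standard w₁) (hf₁ : FiniteNorm w₁) (hj₁ : Jointless w₁)
    (hs₂ : Standard w₂) (hf₂ : FiniteNorm w₂) (hj₂ : Jointless w₂)
    (x₁ x₂ : ℝ) (e₁ e₂ : Edge) (he₁ : w₁ e₁ = x₁) (he₂ : w₂ e₂ = x₂)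
    (hx : (IsGreatest (Set.range w₁) x₁ ∧ IsGreatest (Set.range w₂) x₂) ∨
          (IsLeast (Set.range w₁) x₁ ∧ IsLeast (Set.range w₂) x₂)) :
    Gdist w₁ w₂ =
      Gdist (Function.update w₁ e₁ 0) (Function.update w₂ e₂ 0) +
        ENNReal.ofReal |x₁ - x₂| := by
  subst he₁ he₂
  exact le_antisymm (Gdist_le_del hs₁ hj₁ hs₂ hf₂ hj₂ e₁ e₂)
    (Gdist_del_le hj₁ hs₂.zero_mem_range hx)
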